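/- arXiv:1703.05829 — 8 statements merged into one kernel-verified Lean document; each statement's English description precedes it below -/
import Mathlib

section
/- Under the stated hypotheses, there exists a unique continuous curve X : [0,T] → H satisfying X(t) = P_C( x̄ + t ū + ∫₀ᵗ ∫₀^τ F(s, X(s)) ds dτ ) for all t ∈ [0,T]. (Existence and uniqueness of the constrained trajectory defined by projection of the free motion path.) -/
open MeasureTheory Set
open scoped RealInnerProductSpace

/-- A map satisfying the variational inequality of the metric projection is nonexpansive. -/
theorem lipschitzWith_one_of_inner_nonpos {H : Type*} [NormedAddCommGroup H]
    [InnerProductSpace ℝ H] {C : Set H} {P : H → H}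
    (hP : ∀ x : H, P x ∈ C ∧ ∀ z ∈ C, ⟪x - P x, z - P x⟫ ≤ 0) : LipschitzWith 1 P := by
  refine LipschitzWith.of_dist_le_mul fun x y ↦ ?_
  rw [NNReal.coe_one, one_mul, dist_eq_norm, dist_eq_norm]
  have h : ‖P x - P y‖ * ‖P x - P y‖ ≤ ‖x - y‖ * ‖P x - P y‖ := by
    have h₁ := (hP x).2 _ (hP y).1
    have h₂ := (hP y).2 _ (hP x).1
    have h₃ := real_inner_le_norm (x - y) (P x - P y)
    rw [← real_inner_self_eq_norm_mul_norm]
    simp only [inner_sub_left, inner_sub_right] at h₁ h₂ h₃ ⊢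
    linarith
  rcases (norm_nonneg (P x - P y)).eq_or_lt with h₀ | h₀
  · rw [← h₀]
    exact norm_nonneg _
  · exact le_of_mul_le_mul_right h h₀

/-- The integral over `[0, t]` of a function bounded by `M * s ^ n` is bounded by
`M / (n + 1) * t ^ (n + 1)`. -/
theorem norm_intervalIntegral_le_of_norm_le_mul_pow {E : Type*} [NormedAddCommGroup E]
    [NormedSpace ℝ E] {g : ℝ → E} {M t : ℝ} {n : ℕ} (ht : 0 ≤ t)
    (hg : ∀ s ∈ Icc 0 t, ‖g s‖ ≤ M * s ^ n) :
    ‖∫ s in (0 : ℝ)..t, g s‖ ≤ M / (n + 1) * t ^ (n + 1) := by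
  refine (intervalIntegral.norm_integral_le_of_norm_le ht
    (g := fun s ↦ M * s ^ n) (.of_forall fun s hs ↦ hg s ⟨hs.1.le, hs.2⟩)
    (Continuous.intervalIntegrable (by fun_prop) _ _)).trans_eq ?_
  rw [intervalIntegral.integral_const_mul, integral_pow]
  simp only [ne_eq, Nat.add_eq_zero_iff, one_ne_zero, and_false, not_false_eq_true, zero_pow]
  ring

/-- A self-map of `C([0, T], E)` that gains two powers of `t` in every estimate, as a double
integration does, has a contracting iterate. -/
theorem exists_contractingWith_iterate {E : Type*} [NormedAddCommGroup E] {T k : ℝ} (hT : 0 ≤ T)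
    (hk : 0 ≤ k) {Φ : C(Icc 0 T, E) → C(Icc 0 T, E)}
    (hΦ : ∀ (X Y : C(Icc 0 T, E)) (M : ℝ) (n : ℕ),
      (∀ t, ‖X t - Y t‖ ≤ M * (t : ℝ) ^ n) →
        ∀ t, ‖Φ X t - Φ Y t‖ ≤ k * M / (n + 1) / (n + 2) * (t : ℝ) ^ (n + 2)) :
    ∃ (n : ℕ) (K : NNReal), ContractingWith K Φ^[n] := by
  have hiter (X Y : C(Icc 0 T, E)) (n : ℕ) : ∀ t, ‖Φ^[n] X t - Φ^[n] Y t‖ ≤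
      k ^ n * dist X Y / (2 * n).factorial * (t : ℝ) ^ (2 * n) := by
    induction n with
    | zero =>
      intro t
      simpa [dist_eq_norm] using ContinuousMap.dist_apply_le_dist (f := X) (g := Y) t
    | succ n ih =>
      intro t
      rw [Function.iterate_succ_apply', Function.iterate_succ_apply']
      refine (hΦ _ _ _ _ ih t).trans_eq ?_
      rw [show 2 * (n + 1) = 2 * n + 1 + 1 by ring, Nat.factorial_succ, Nat.factorial_succ]
      push_cast
      field_simp
      ring
  have hlim : Filter.Tendsto (fun n : ℕ ↦ (√k * T) ^ (2 * n) / (2 * n).factorial)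
      Filter.atTop (nhds 0) :=
    (FloorSemiring.tendsto_pow_div_factorial_atTop (√k * T)).comp
      (Filter.tendsto_id.const_mul_atTop' two_pos)
  obtain ⟨n, hn⟩ := (hlim.eventually_lt_const one_pos).exists
  have h₀ : 0 ≤ (√k * T) ^ (2 * n) / (2 * n).factorial := by positivity
  refine ⟨n, ⟨_, h₀⟩, by exact_mod_cast hn, LipschitzWith.of_dist_le_mul fun X Y ↦ ?_⟩
  refine (ContinuousMap.dist_le (by positivity)).2 fun t ↦ ?_
  rw [dist_eq_norm]
  refine (hiter X Y n t).trans ?_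
  have ht : (t : ℝ) ^ (2 * n) ≤ T ^ (2 * n) := pow_le_pow_left₀ t.2.1 t.2.2 _
  calc k ^ n * dist X Y / (2 * n).factorial * (t : ℝ) ^ (2 * n)
      ≤ k ^ n * dist X Y / (2 * n).factorial * T ^ (2 * n) := by gcongr
    _ = (√k * T) ^ (2 * n) / (2 * n).factorial * dist X Y := by
      rw [mul_pow, pow_mul √k, Real.sq_sqrt hk]
      ring

/-- **Existence and uniqueness of the constrained trajectory** defined by metric
projection of the free motion path onto the closed convex set `C`. -/
theorem exists_unique_projected_trajectory
    {H : Type*} [NormedAddCommGroup H] [InnerProductSpace ℝ H] [CompleteSpace H]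
    (C : Set H) (hCne : C.Nonempty) (hCcl : IsClosed C) (hCcv : Convex ℝ C)
    (P : H → H)
    (hP : ∀ x : H, P x ∈ C ∧ ∀ z ∈ C, ⟪x - P x, z - P x⟫ ≤ 0)
    (T : ℝ) (hT : 0 < T) (k : ℝ) (hk : 0 < k)
    (F : ℝ → H → H)
    (hFc : ContinuousOn (Function.uncurry F) (Icc 0 T ×ˢ univ))
    (hFlip : ∀ t ∈ Icc 0 T, ∀ x y : H, ‖F t x - F t y‖ ≤ k * ‖x - y‖)
    (xbar ubar : H) :
    ∃ X : ℝ → H, ContinuousOn X (Icc 0 T) ∧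
      (∀ t ∈ Icc 0 T,
        X t = P (xbar + t • ubar + ∫ τ in (0:ℝ)..t, ∫ s in (0:ℝ)..τ, F s (X s))) ∧
      ∀ Y : ℝ → H, ContinuousOn Y (Icc 0 T) →
        (∀ t ∈ Icc 0 T,
          Y t = P (xbar + t • ubar + ∫ τ in (0:ℝ)..t, ∫ s in (0:ℝ)..τ, F s (Y s))) →
        ∀ t ∈ Icc 0 T, Y t = X t := by
  have hPlip := lipschitzWith_one_of_inner_nonpos hP
  let π : ℝ → Icc 0 T := projIcc 0 T hT.le
  have hπc : Continuous π := continuous_projIcc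
  have hπ {s : ℝ} (hs : s ∈ Icc 0 T) : π s = ⟨s, hs⟩ := projIcc_of_mem hT.le hs
  let G (X : C(Icc 0 T, H)) (s : ℝ) : H := F (π s) (X (π s))
  have hG (X : C(Icc 0 T, H)) : Continuous (G X) :=
    hFc.comp_continuous (f := fun s ↦ ((π s : ℝ), X (π s))) (by fun_prop)
      fun s ↦ ⟨(π s).2, mem_univ _⟩
  have hGi (X : C(Icc 0 T, H)) : Continuous fun τ ↦ ∫ s in (0 : ℝ)..τ, G X s :=
    intervalIntegral.continuous_primitive (fun a b ↦ (hG X).intervalIntegrable a b) 0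
  have hGii (X : C(Icc 0 T, H)) :
      Continuous fun t ↦ ∫ τ in (0 : ℝ)..t, ∫ s in (0 : ℝ)..τ, G X s :=
    intervalIntegral.continuous_primitive (fun a b ↦ (hGi X).intervalIntegrable a b) 0
  let Φ (X : C(Icc 0 T, H)) : C(Icc 0 T, H) :=
    { toFun := fun t ↦
        P (xbar + (t : ℝ) • ubar + ∫ τ in (0 : ℝ)..t, ∫ s in (0 : ℝ)..τ, G X s)
      continuous_toFun := hPlip.continuous.comp
        ((by fun_prop : Continuous fun t : Icc 0 T ↦ xbar + (t : ℝ) • ubar).add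
          ((hGii X).comp continuous_subtype_val)) }
  have hGF (X : C(Icc 0 T, H)) (Y : ℝ → H) (hXY : ∀ s (hs : s ∈ Icc 0 T), X ⟨s, hs⟩ = Y s)
      (t : ℝ) (ht : t ∈ Icc 0 T) :
      ∫ τ in (0 : ℝ)..t, ∫ s in (0 : ℝ)..τ, G X s =
        ∫ τ in (0 : ℝ)..t, ∫ s in (0 : ℝ)..τ, F s (Y s) := by
    refine intervalIntegral.integral_congr fun τ hτ ↦ intervalIntegral.integral_congr fun s hs ↦ ?_
    rw [uIcc_of_le ht.1] at hτ
    rw [uIcc_of_le hτ.1] at hs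
    have hs' : s ∈ Icc 0 T := ⟨hs.1, hs.2.trans (hτ.2.trans ht.2)⟩
    simp only [G, hπ hs', hXY s hs']
  have hΦ (X Y : C(Icc 0 T, H)) (M : ℝ) (n : ℕ) (hXY : ∀ t, ‖X t - Y t‖ ≤ M * (t : ℝ) ^ n)
      (t : Icc 0 T) :
      ‖Φ X t - Φ Y t‖ ≤ k * M / (n + 1) / (n + 2) * (t : ℝ) ^ (n + 2) := by
    refine (hPlip.norm_sub_le _ _).trans ?_
    rw [NNReal.coe_one, one_mul, add_sub_add_left_eq_sub, ← intervalIntegral.integral_sub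
      ((hGi X).intervalIntegrable _ _) ((hGi Y).intervalIntegrable _ _)]
    refine (norm_intervalIntegral_le_of_norm_le_mul_pow (M := k * M / (n + 1)) (n := n + 1)
      t.2.1 fun τ hτ ↦ ?_).trans_eq (by push_cast; ring)
    rw [← intervalIntegral.integral_sub
      ((hG X).intervalIntegrable _ _) ((hG Y).intervalIntegrable _ _)]
    refine norm_intervalIntegral_le_of_norm_le_mul_pow hτ.1 fun s hs ↦ ?_
    have hs' : s ∈ Icc 0 T := ⟨hs.1, hs.2.trans (hτ.2.trans t.2.2)⟩
    simp only [G, hπ hs']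
    refine (hFlip s hs' _ _).trans ?_
    rw [mul_assoc]
    exact mul_le_mul_of_nonneg_left (hXY ⟨s, hs'⟩) hk.le
  obtain ⟨n, K, hK⟩ := exists_contractingWith_iterate hT.le hk.le hΦ
  have hfix : Function.IsFixedPt Φ (hK.fixedPoint _) := hK.isFixedPt_fixedPoint_iterate
  set Z : C(Icc 0 T, H) := hK.fixedPoint _
  refine ⟨fun t ↦ Z (π t), (Z.continuous.comp hπc).continuousOn, fun t ht ↦ ?_,
    fun Y hYc hY t ht ↦ ?_⟩
  · rw [← hGF Z (fun s ↦ Z (π s)) (fun s hs ↦ by simp only [hπ hs]) t ht]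
    simp only [hπ ht]
    exact (DFunLike.congr_fun hfix ⟨t, ht⟩).symm
  · let W : C(Icc 0 T, H) := ⟨(Icc 0 T).domRestrict Y, hYc.domRestrict⟩
    have hW : Function.IsFixedPt Φ W := by
      ext s
      change P _ = Y s
      rw [hGF W Y (fun _ _ ↦ rfl) s s.2, ← hY s s.2]
    have hWZ : W = Z := hK.fixedPoint_unique (hW.iterate n)
    simp only [hπ ht, ← hWZ]
    rfl
end

section
/- The map 𝒯 is a 1/4-contraction for the weighted uniform norm: for all X¹, X² ∈ C([0,T],H) with X¹(0) = X²(0), one has max_{t∈[0,T]} e^{−2√k t} ‖𝒯(X¹)(t) − 𝒯(X²)(t)‖ ≤ (1/4) · max_{t∈[0,T]} e^{−2√k t} ‖X¹(t) − X²(t)‖. -/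
open MeasureTheory Set
open scoped RealInnerProductSpace

/-- The map `𝒯(X)(t) = P_C(x̄ + t ū + ∫₀ᵗ∫₀^τ F(s, X(s)) ds dτ)`. -/
noncomputable def freePathMap {H : Type*} [NormedAddCommGroup H] [InnerProductSpace ℝ H]
    [CompleteSpace H] (P : H → H) (F : ℝ → H → H) (xbar ubar : H)
    (X : ℝ → H) (t : ℝ) : H :=
  P (xbar + t • ubar + ∫ τ in (0:ℝ)..t, ∫ s in (0:ℝ)..τ, F s (X s))

theorem norm_sub_le_of_inner_sub_nonpos
    {H : Type*} [NormedAddCommGroup H] [InnerProductSpace ℝ H] {x y p q : H}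
    (hp : ⟪x - p, q - p⟫ ≤ 0) (hq : ⟪y - q, p - q⟫ ≤ 0) : ‖p - q‖ ≤ ‖x - y‖ := by
  have h : ‖p - q‖ * ‖p - q‖ ≤ ⟪x - y, p - q⟫ := by
    rw [← real_inner_self_eq_norm_mul_norm]
    simp only [inner_sub_left, inner_sub_right] at hp hq ⊢
    linarith
  have h' := h.trans (real_inner_le_norm _ _)
  by_contra! hlt
  nlinarith [norm_nonneg (x - y)]

theorem norm_intervalIntegral_le_exp
    {E : Type*} [NormedAddCommGroup E] [NormedSpace ℝ E] {f : ℝ → E} {A l t : ℝ}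
    (hA : 0 ≤ A) (hl : 0 < l) (ht : 0 ≤ t)
    (hf : ∀ s ∈ Icc 0 t, ‖f s‖ ≤ A * Real.exp (l * s)) :
    ‖∫ s in (0:ℝ)..t, f s‖ ≤ A / l * Real.exp (l * t) := by
  have hb : Continuous fun s : ℝ => A * Real.exp (l * s) := by fun_prop
  have hd : ∀ s ∈ uIcc 0 t,
      HasDerivAt (fun s : ℝ => A / l * Real.exp (l * s)) (A * Real.exp (l * s)) s := by
    intro s _
    refine ((((hasDerivAt_id' s).const_mul l).exp).const_mul (A / l)).congr_deriv ?_
    field_simp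
  calc ‖∫ s in (0:ℝ)..t, f s‖ ≤ ∫ s in (0:ℝ)..t, A * Real.exp (l * s) :=
        intervalIntegral.norm_integral_le_of_norm_le ht
          (Filter.Eventually.of_forall fun s hs => hf s ⟨hs.1.le, hs.2⟩)
          (hb.intervalIntegrable 0 t)
    _ = A / l * Real.exp (l * t) - A / l * Real.exp (l * 0) :=
        intervalIntegral.integral_eq_sub_of_hasDerivAt hd (hb.intervalIntegrable 0 t)
    _ ≤ A / l * Real.exp (l * t) := sub_le_self _ (by positivity)

theorem ContinuousOn.intervalIntegral_upper
    {E : Type*} [NormedAddCommGroup E] [NormedSpace ℝ E] {f : ℝ → E} {T : ℝ}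
    (hT : 0 ≤ T) (hf : ContinuousOn f (Icc 0 T)) :
    ContinuousOn (fun t => ∫ s in (0:ℝ)..t, f s) (Icc 0 T) := by
  have h := intervalIntegral.continuousOn_primitive_interval (a := 0) (b := T) (μ := volume)
    (f := f) (by rw [uIcc_of_le hT]; exact hf.integrableOn_Icc)
  rwa [uIcc_of_le hT] at h

theorem ContinuousOn.intervalIntegrable_zero_of_mem
    {E : Type*} [NormedAddCommGroup E] {f : ℝ → E} {T t : ℝ}
    (hf : ContinuousOn f (Icc 0 T)) (ht : t ∈ Icc 0 T) : IntervalIntegrable f volume 0 t :=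
  ContinuousOn.intervalIntegrable <| hf.mono <| by
    rw [uIcc_of_le ht.1]; exact Icc_subset_Icc_right ht.2

/-- **`𝒯` is a 1/4-contraction** for the weighted uniform norm
`max_{t ∈ [0,T]} e^{-2√k t} ‖·‖`. -/
theorem freePathMap_quarter_contraction
    {H : Type*} [NormedAddCommGroup H] [InnerProductSpace ℝ H] [CompleteSpace H]
    (C : Set H) (hCne : C.Nonempty) (hCcl : IsClosed C) (hCcv : Convex ℝ C)
    (P : H → H)
    (hP : ∀ x : H, P x ∈ C ∧ ∀ z ∈ C, ⟪x - P x, z - P x⟫ ≤ 0)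
    (T : ℝ) (hT : 0 < T) (k : ℝ) (hk : 0 < k)
    (F : ℝ → H → H)
    (hFc : ContinuousOn (Function.uncurry F) (Icc 0 T ×ˢ univ))
    (hFlip : ∀ t ∈ Icc 0 T, ∀ x y : H, ‖F t x - F t y‖ ≤ k * ‖x - y‖)
    (xbar ubar : H)
    (X₁ X₂ : ℝ → H) (hX₁ : ContinuousOn X₁ (Icc 0 T)) (hX₂ : ContinuousOn X₂ (Icc 0 T))
    (h0 : X₁ 0 = X₂ 0) :
    (⨆ t : Icc (0:ℝ) T, Real.exp (-2 * Real.sqrt k * t) *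
        ‖freePathMap P F xbar ubar X₁ t - freePathMap P F xbar ubar X₂ t‖) ≤
      (1/4) * ⨆ t : Icc (0:ℝ) T, Real.exp (-2 * Real.sqrt k * t) * ‖X₁ t - X₂ t‖ := by
  set l : ℝ := 2 * Real.sqrt k with hl
  have hl0 : 0 < l := by positivity
  have hl2 : l * l = 4 * k := by
    rw [hl]; nlinarith [Real.mul_self_sqrt hk.le]
  have hneg : ∀ t : ℝ, -2 * Real.sqrt k * t = -(l * t) := fun t => by rw [hl]; ring
  simp only [hneg]
  set M : ℝ := ⨆ t : Icc (0:ℝ) T, Real.exp (-(l * t)) * ‖X₁ t - X₂ t‖ with hM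
  have hM0 : 0 ≤ M := Real.iSup_nonneg fun t => by positivity
  have hbdd : BddAbove (range fun t : Icc (0:ℝ) T => Real.exp (-(l * t)) * ‖X₁ t - X₂ t‖) := by
    have hc : ContinuousOn (fun t : ℝ => Real.exp (-(l * t)) * ‖X₁ t - X₂ t‖) (Icc 0 T) :=
      ContinuousOn.mul (by fun_prop) (hX₁.sub hX₂).norm
    have h := isCompact_Icc.bddAbove_image hc
    rwa [image_eq_range] at h
  have hX : ∀ t ∈ Icc 0 T, ‖X₁ t - X₂ t‖ ≤ M * Real.exp (l * t) := by
    intro t ht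
    have h := le_ciSup hbdd ⟨t, ht⟩
    rwa [Real.exp_neg, inv_mul_le_iff₀ (Real.exp_pos _), mul_comm] at h
  have hcomp : ∀ X : ℝ → H, ContinuousOn X (Icc 0 T) →
      ContinuousOn (fun s => F s (X s)) (Icc 0 T) := fun X hX =>
    hFc.comp (continuousOn_id.prodMk hX) fun s hs => ⟨hs, mem_univ _⟩
  have hG₁ := hcomp X₁ hX₁
  have hG₂ := hcomp X₂ hX₂
  have hinner : ∀ τ ∈ Icc 0 T,
      ‖(∫ s in (0:ℝ)..τ, F s (X₁ s)) - ∫ s in (0:ℝ)..τ, F s (X₂ s)‖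
        ≤ k * M / l * Real.exp (l * τ) := by
    intro τ hτ
    rw [← intervalIntegral.integral_sub (hG₁.intervalIntegrable_zero_of_mem hτ)
      (hG₂.intervalIntegrable_zero_of_mem hτ)]
    refine norm_intervalIntegral_le_exp (by positivity) hl0 hτ.1 fun s hs => ?_
    have hs' : s ∈ Icc 0 T := ⟨hs.1, hs.2.trans hτ.2⟩
    rw [mul_assoc]
    exact (hFlip s hs' _ _).trans (mul_le_mul_of_nonneg_left (hX s hs') hk.le)
  have : Nonempty (Icc (0:ℝ) T) := ⟨⟨0, le_rfl, hT.le⟩⟩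
  refine ciSup_le fun ⟨t, ht⟩ => ?_
  rw [Real.exp_neg, inv_mul_le_iff₀ (Real.exp_pos _)]
  have hI₁ := (hG₁.intervalIntegral_upper hT.le).intervalIntegrable_zero_of_mem ht
  have hI₂ := (hG₂.intervalIntegral_upper hT.le).intervalIntegrable_zero_of_mem ht
  calc ‖freePathMap P F xbar ubar X₁ t - freePathMap P F xbar ubar X₂ t‖
      ≤ ‖(∫ τ in (0:ℝ)..t, ∫ s in (0:ℝ)..τ, F s (X₁ s)) -
          ∫ τ in (0:ℝ)..t, ∫ s in (0:ℝ)..τ, F s (X₂ s)‖ := by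
        refine (norm_sub_le_of_inner_sub_nonpos ((hP _).2 _ (hP _).1)
          ((hP _).2 _ (hP _).1)).trans_eq ?_
        rw [add_sub_add_left_eq_sub]
    _ ≤ k * M / l / l * Real.exp (l * t) := by
        rw [← intervalIntegral.integral_sub hI₁ hI₂]
        exact norm_intervalIntegral_le_exp (by positivity) hl0 ht.1 fun τ hτ =>
          hinner τ ⟨hτ.1, hτ.2.trans ht.2⟩
    _ = Real.exp (l * t) * (1 / 4 * M) := by
        rw [div_div, hl2]; field_simp
end

section
/- If in addition ‖F(t,x)‖ ≤ M for all t ∈ [0,T] and x ∈ H, then the unique fixed point X of 𝒯 is Lipschitz in time: ‖X(t+h) − X(t)‖ ≤ |h| · ( ‖ū‖ + T·M ) for all t, t+h ∈ [0,T]. -/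
open MeasureTheory Set
open scoped RealInnerProductSpace

/-- A map satisfying the variational inequality of the metric projection is nonexpansive. -/
theorem norm_sub_le_of_inner_sub_nonpos_s2 {H : Type*} [NormedAddCommGroup H]
    [InnerProductSpace ℝ H] {C : Set H} {P : H → H}
    (hP : ∀ x : H, P x ∈ C ∧ ∀ z ∈ C, ⟪x - P x, z - P x⟫ ≤ 0) (x y : H) :
    ‖P x - P y‖ ≤ ‖x - y‖ := by
  have h₁ := (hP x).2 _ (hP y).1
  have h₂ := (hP y).2 _ (hP x).1
  have hsq : ‖P x - P y‖ * ‖P x - P y‖ ≤ ⟪x - y, P x - P y⟫ := by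
    rw [← real_inner_self_eq_norm_mul_norm]
    simp only [inner_sub_left, inner_sub_right] at h₁ h₂ ⊢
    linarith
  have hcs := real_inner_le_norm (x - y) (P x - P y)
  by_contra! hlt
  nlinarith [norm_nonneg (x - y)]

/-- The second primitive of a function bounded by `M` on `[0, T]` is Lipschitz with
constant `T * M`. -/
theorem norm_integral_integral_sub_le {E : Type*} [NormedAddCommGroup E] [NormedSpace ℝ E]
    {f : ℝ → E} {T M : ℝ} (hf : ContinuousOn f (Icc 0 T))
    (hM : ∀ s ∈ Icc 0 T, ‖f s‖ ≤ M) {a b : ℝ} (ha : a ∈ Icc 0 T) (hb : b ∈ Icc 0 T) :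
    ‖(∫ τ in (0:ℝ)..b, ∫ s in (0:ℝ)..τ, f s) - ∫ τ in (0:ℝ)..a, ∫ s in (0:ℝ)..τ, f s‖
      ≤ T * M * |b - a| := by
  have hT : 0 ≤ T := ha.1.trans ha.2
  have hM0 : 0 ≤ M := (norm_nonneg _).trans (hM a ha)
  have hprim : ContinuousOn (fun τ => ∫ s in (0:ℝ)..τ, f s) (Icc 0 T) := by
    have h := intervalIntegral.continuousOn_primitive_interval (μ := volume) (a := 0) (b := T)
      (f := f) (by rw [uIcc_of_le hT]; exact hf.integrableOn_Icc)
    rwa [uIcc_of_le hT] at h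
  have hint : ∀ c ∈ Icc 0 T,
      IntervalIntegrable (fun τ => ∫ s in (0:ℝ)..τ, f s) volume 0 c := fun c hc =>
    (hprim.mono (by rw [uIcc_of_le hc.1]; exact Icc_subset_Icc_right hc.2)).intervalIntegrable
  rw [intervalIntegral.integral_interval_sub_left (hint b hb) (hint a ha)]
  refine intervalIntegral.norm_integral_le_of_norm_le_const fun τ hτ => ?_
  have hτT : τ ∈ Icc 0 T := uIcc_subset_Icc ha hb (uIoc_subset_uIcc hτ)
  have hbound : ‖∫ s in (0:ℝ)..τ, f s‖ ≤ M * |τ - 0| :=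
    intervalIntegral.norm_integral_le_of_norm_le_const fun s hs => by
      rw [uIoc_of_le hτT.1] at hs
      exact hM s ⟨hs.1.le, hs.2.trans hτT.2⟩
  rw [sub_zero, abs_of_nonneg hτT.1] at hbound
  nlinarith [mul_le_mul_of_nonneg_left hτT.2 hM0]

/-- If `‖F(t,x)‖ ≤ M`, then the fixed point `X` of `𝒯` (the projected free-motion
trajectory) is Lipschitz in time with constant `‖ū‖ + T·M`. -/
theorem fixedPoint_lipschitz_in_time
    {H : Type*} [NormedAddCommGroup H] [InnerProductSpace ℝ H] [CompleteSpace H]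
    (C : Set H) (hCne : C.Nonempty) (hCcl : IsClosed C) (hCcv : Convex ℝ C)
    (P : H → H)
    (hP : ∀ x : H, P x ∈ C ∧ ∀ z ∈ C, ⟪x - P x, z - P x⟫ ≤ 0)
    (T : ℝ) (hT : 0 < T) (k : ℝ) (hk : 0 < k) (M : ℝ) (hM : 0 ≤ M)
    (F : ℝ → H → H)
    (hFc : ContinuousOn (Function.uncurry F) (Icc 0 T ×ˢ univ))
    (hFlip : ∀ t ∈ Icc 0 T, ∀ x y : H, ‖F t x - F t y‖ ≤ k * ‖x - y‖)
    (hFbd : ∀ t ∈ Icc 0 T, ∀ x : H, ‖F t x‖ ≤ M)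
    (xbar ubar : H)
    (X : ℝ → H) (hXc : ContinuousOn X (Icc 0 T))
    (hfix : ∀ t ∈ Icc 0 T,
      X t = P (xbar + t • ubar + ∫ τ in (0:ℝ)..t, ∫ s in (0:ℝ)..τ, F s (X s))) :
    ∀ t h : ℝ, t ∈ Icc 0 T → t + h ∈ Icc 0 T →
      ‖X (t + h) - X t‖ ≤ |h| * (‖ubar‖ + T * M) := by
  intro t h ht hth
  have hf : ContinuousOn (fun s => F s (X s)) (Icc 0 T) :=
    hFc.comp (continuousOn_id.prodMk hXc) fun s hs => ⟨hs, mem_univ _⟩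
  have hI := norm_integral_integral_sub_le hf (fun s hs => hFbd s hs (X s)) ht hth
  rw [add_sub_cancel_left] at hI
  rw [hfix t ht, hfix (t + h) hth]
  refine (norm_sub_le_of_inner_sub_nonpos_s2 hP _ _).trans ?_
  have hu : ‖h • ubar‖ = |h| * ‖ubar‖ := by rw [norm_smul, Real.norm_eq_abs]
  rw [add_sub_add_comm, add_sub_add_left_eq_sub, add_smul, add_sub_cancel_left]
  refine (norm_add_le _ _).trans ?_
  linarith
end

section
/- Let μ be a Borel measure on ℝ, let S : ℝ → ℝ and U : ℝ → ℝ be functions, and suppose there exist sequences of nondecreasing functions (Wₖ), (W'ₖ) from ℝ to ℝ and positive real numbers (λₖ), (λ'ₖ) such that Wₖ − λₖ S → U μ-almost everywhere and W'ₖ − λ'ₖ S → −U μ-almost everywhere. Then there exists a μ-null set B ⊆ ℝ such that for all y₁, y₂ ∈ ℝ \ B with S(y₁) = S(y₂), one has U(y₁) = U(y₂). -/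
open MeasureTheory Filter

/-- If `U` and `-U` are `μ`-a.e. limits of sequences of the form `Wₖ - λₖ S` with `Wₖ`
nondecreasing and `λₖ > 0`, then off a `μ`-null set `B` the function `U` is constant on
the level sets of `S`. -/
theorem ae_constant_on_levels_of_two_sided_monotone_approx
    (μ : Measure ℝ) (S U : ℝ → ℝ)
    (W W' : ℕ → ℝ → ℝ) (l l' : ℕ → ℝ)
    (hW : ∀ n, Monotone (W n)) (hW' : ∀ n, Monotone (W' n))
    (hl : ∀ n, 0 < l n) (hl' : ∀ n, 0 < l' n)
    (hconv : ∀ᵐ y ∂μ, Tendsto (fun n => W n y - l n * S y) atTop (nhds (U y)))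
    (hconv' : ∀ᵐ y ∂μ, Tendsto (fun n => W' n y - l' n * S y) atTop (nhds (-U y))) :
    ∃ B : Set ℝ, μ B = 0 ∧
      ∀ y₁ ∉ B, ∀ y₂ ∉ B, S y₁ = S y₂ → U y₁ = U y₂ := by
  have key : ∀ {V : ℝ → ℝ} {X : ℕ → ℝ → ℝ} {m : ℕ → ℝ} {y₁ y₂ : ℝ}, (∀ n, Monotone (X n)) →
      Tendsto (fun n => X n y₁ - m n * S y₁) atTop (nhds (V y₁)) →
      Tendsto (fun n => X n y₂ - m n * S y₂) atTop (nhds (V y₂)) →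
      S y₁ = S y₂ → y₁ ≤ y₂ → V y₁ ≤ V y₂ := by
    intro V X m y₁ y₂ hX h₁ h₂ hS hy
    rw [hS] at h₁
    exact le_of_tendsto_of_tendsto' h₁ h₂ fun n => sub_le_sub_right (hX n hy) _
  refine ⟨_, ae_iff.mp (hconv.and hconv'), fun y₁ h₁ y₂ h₂ hS => ?_⟩
  obtain ⟨h₁, h₁'⟩ := not_not.mp h₁
  obtain ⟨h₂, h₂'⟩ := not_not.mp h₂
  rcases le_total y₁ y₂ with hy | hy
  · exact le_antisymm (key hW h₁ h₂ hS hy)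
      (neg_le_neg_iff.mp (key (V := fun y => -U y) hW' h₁' h₂' hS hy))
  · exact le_antisymm (neg_le_neg_iff.mp (key (V := fun y => -U y) hW' h₂' h₁' hS.symm hy))
      (key hW h₂ h₁ hS.symm hy)
end

section
/- Let μ be a finite Borel measure on ℝ, let K ⊆ L²(ℝ, μ) be the set of (equivalence classes of) functions admitting a nondecreasing representative, let X̃ ∈ K be fixed, and let K̃ := { X̃ + S : S ∈ K }, which is a nonempty closed convex subset of L²(ℝ, μ). Given Y ∈ L²(ℝ, μ), let X := P_{K̃}(Y) be the metric projection of Y onto K̃, and set S := X − X̃ ∈ K. Then for every bounded Lipschitz function φ : ℝ → ℝ the following hold: (i) φ ∘ S belongs to the tangent cone T_S K := ⋃_{h>0} h·(K − S), i.e. there exist h > 0 and Z ∈ K with φ ∘ S = h(Z − S); (ii) ⟨ Y − X, φ ∘ S ⟩_{L²(ℝ,μ)} = 0. -/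
open MeasureTheory
open scoped RealInnerProductSpace

/-- The cone `K ⊆ L²(ℝ, μ)` of classes of functions admitting a nondecreasing
representative. -/
def monotoneConeL2 (μ : MeasureTheory.Measure ℝ) : Set (MeasureTheory.Lp ℝ 2 μ) :=
  {f | ∃ g : ℝ → ℝ, Monotone g ∧ ⇑f =ᵐ[μ] g}

/-- If `φ` is `L`-Lipschitz, then `x ↦ x + (L + 1)⁻¹ φ x` is nondecreasing. -/
lemma LipschitzWith.monotone_add_inv_mul {φ : ℝ → ℝ} {L : NNReal} (hφ : LipschitzWith L φ) :
    Monotone fun x => x + ((L : ℝ) + 1)⁻¹ * φ x := by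
  intro x y hxy
  have hL : (0 : ℝ) < L + 1 := by positivity
  have hdist := hφ.dist_le_mul x y
  rw [Real.dist_eq, Real.dist_eq, abs_sub_comm x y, abs_of_nonneg (sub_nonneg.2 hxy)] at hdist
  have hle : φ x - φ y ≤ (L + 1) * (y - x) := by
    linarith [le_abs_self (φ x - φ y)]
  have hdiv : ((L : ℝ) + 1)⁻¹ * (φ x - φ y) ≤ y - x := (inv_mul_le_iff₀ hL).2 hle
  show x + ((L : ℝ) + 1)⁻¹ * φ x ≤ y + ((L : ℝ) + 1)⁻¹ * φ y
  linarith

/-- The class of `φ ∘ S`, with `φ` Lipschitz and `S` in the monotone cone, lies in the tangent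
cone at `S`. -/
lemma exists_eq_smul_sub_of_ae_eq_comp {μ : Measure ℝ} {S G : Lp ℝ 2 μ}
    (hS : S ∈ monotoneConeL2 μ) {φ : ℝ → ℝ} {L : NNReal} (hφ : LipschitzWith L φ)
    (hG : G =ᵐ[μ] fun y => φ (S y)) :
    ∃ h : ℝ, 0 < h ∧ ∃ Z ∈ monotoneConeL2 μ, G = h • (Z - S) := by
  obtain ⟨g, hg, hSg⟩ := hS
  have hL : (0 : ℝ) < L + 1 := by positivity
  refine ⟨L + 1, hL, S + ((L : ℝ) + 1)⁻¹ • G, ⟨_, hφ.monotone_add_inv_mul.comp hg, ?_⟩, ?_⟩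
  · filter_upwards [Lp.coeFn_add S (((L : ℝ) + 1)⁻¹ • G), Lp.coeFn_smul ((L : ℝ) + 1)⁻¹ G,
      hG, hSg] with y hadd hsmul hGy hSy
    rw [hadd, Pi.add_apply, hsmul, Pi.smul_apply, hGy, hSy, smul_eq_mul, Function.comp_apply]
  · rw [add_sub_cancel_left, smul_inv_smul₀ hL.ne']

/-- If `X` is the metric projection of `Y` onto `K̃ = X̃ + K` and `S = X - X̃`, then for
every bounded Lipschitz `φ : ℝ → ℝ` the class `G` of `φ ∘ S` (i) belongs to the tangent
cone `T_S K = ⋃_{h>0} h (K - S)` and (ii) is orthogonal to `Y - X`. -/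
theorem comp_mem_tangentCone_and_orthogonal
    (μ : MeasureTheory.Measure ℝ) [IsFiniteMeasure μ]
    (Xtilde : MeasureTheory.Lp ℝ 2 μ) (hXtilde : Xtilde ∈ monotoneConeL2 μ)
    (Y X : MeasureTheory.Lp ℝ 2 μ)
    (hXmem : X ∈ {f | ∃ s ∈ monotoneConeL2 μ, f = Xtilde + s})
    (hproj : ∀ z ∈ {f | ∃ s ∈ monotoneConeL2 μ, f = Xtilde + s}, ⟪Y - X, z - X⟫ ≤ 0)
    (φ : ℝ → ℝ) (Lφ : NNReal) (hφ : LipschitzWith Lφ φ)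
    (Mφ : ℝ) (hφb : ∀ x : ℝ, |φ x| ≤ Mφ) :
    ∃ G : MeasureTheory.Lp ℝ 2 μ,
      (⇑G =ᵐ[μ] fun y => φ ((X - Xtilde) y)) ∧
      (∃ h : ℝ, 0 < h ∧ ∃ Z ∈ monotoneConeL2 μ, G = h • (Z - (X - Xtilde))) ∧
      ⟪Y - X, G⟫ = 0 := by
  obtain ⟨S, hS, rfl⟩ := hXmem
  rw [add_sub_cancel_left]
  have hmem : MemLp (fun y => φ (S y)) 2 μ :=
    MemLp.of_bound (hφ.continuous.comp_aestronglyMeasurable (Lp.aestronglyMeasurable S)) Mφ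
      (.of_forall fun y => hφb (S y))
  have hG := hmem.coeFn_toLp
  have hGneg : ⇑(-hmem.toLp) =ᵐ[μ] fun y => (-φ) (S y) := by
    filter_upwards [Lp.coeFn_neg hmem.toLp, hG] with y hneg hy
    rw [hneg, Pi.neg_apply, hy, Pi.neg_apply]
  have hinner : ∀ F : Lp ℝ 2 μ,
      (∃ h : ℝ, 0 < h ∧ ∃ Z ∈ monotoneConeL2 μ, F = h • (Z - S)) →
        ⟪Y - (Xtilde + S), F⟫ ≤ 0 := by
    rintro _ ⟨h, hh, Z, hZ, rfl⟩
    have hle := hproj (Xtilde + Z) ⟨Z, hZ, rfl⟩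
    rw [add_sub_add_left_eq_sub] at hle
    rw [real_inner_smul_right]
    exact mul_nonpos_of_nonneg_of_nonpos hh.le hle
  have htan := exists_eq_smul_sub_of_ae_eq_comp hS hφ hG
  refine ⟨hmem.toLp, hG, htan, le_antisymm (hinner _ htan) ?_⟩
  have hle := hinner _ (exists_eq_smul_sub_of_ae_eq_comp hS hφ.neg hGneg)
  rwa [inner_neg_right, neg_nonpos] at hle
end

section
/- Let H be a real Hilbert space, C ⊆ H a nonempty closed convex set, and P_C the metric projection onto C. Let Y : [0,T] → H and set X(t) := P_C(Y(t)). Suppose both Y and X are differentiable at t₀ ∈ (0,T), with derivatives Y'(t₀) and X'(t₀) (limits of difference quotients in the norm of H). Then ⟨ Y'(t₀) − X'(t₀), X'(t₀) ⟩ ≥ 0. -/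
open Set
open scoped RealInnerProductSpace

/-- A map satisfying the variational characterization of the metric projection onto `C` is firmly
nonexpansive. -/
theorem inner_sub_sub_sub_nonneg_of_variational_ineq
    {H : Type*} [NormedAddCommGroup H] [InnerProductSpace ℝ H] {C : Set H} {P : H → H}
    (hP : ∀ x : H, P x ∈ C ∧ ∀ z ∈ C, ⟪x - P x, z - P x⟫ ≤ 0) (x y : H) :
    0 ≤ ⟪(x - y) - (P x - P y), P x - P y⟫ := by
  have hx := (hP x).2 (P y) (hP y).1
  have hy := (hP y).2 (P x) (hP x).1
  simp only [inner_sub_left, inner_sub_right] at hx hy ⊢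
  linarith

/-- If `X(t) = P_C(Y(t))` and both `Y` and `X` are differentiable at `t₀ ∈ (0,T)`, then
`⟨Y'(t₀) - X'(t₀), X'(t₀)⟩ ≥ 0`. -/
theorem inner_derivFree_sub_deriv_with_deriv_nonneg
    {H : Type*} [NormedAddCommGroup H] [InnerProductSpace ℝ H] [CompleteSpace H]
    (C : Set H) (hCne : C.Nonempty) (hCcl : IsClosed C) (hCcv : Convex ℝ C)
    (P : H → H)
    (hP : ∀ x : H, P x ∈ C ∧ ∀ z ∈ C, ⟪x - P x, z - P x⟫ ≤ 0)
    (T : ℝ) (Y : ℝ → H) (t₀ : ℝ) (ht₀ : t₀ ∈ Ioo 0 T)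
    (v w : H) (hY : HasDerivAt Y v t₀) (hX : HasDerivAt (fun t => P (Y t)) w t₀) :
    0 ≤ ⟪v - w, w⟫ := by
  have hlim := (hY.tendsto_slope.sub hX.tendsto_slope).inner (𝕜 := ℝ) hX.tendsto_slope
  refine ge_of_tendsto' hlim fun t => ?_
  simp only [slope_def_module, ← smul_sub, real_inner_smul_left, real_inner_smul_right]
  rw [← mul_assoc]
  exact mul_nonneg (mul_self_nonneg _) (inner_sub_sub_sub_nonneg_of_variational_ineq hP _ _)
end

section
/- Let H be a real Hilbert space, C ⊆ H a nonempty closed convex set, and P_C the metric projection onto C. Let Y : [0,T] → H and set X(t) := P_C(Y(t)). Suppose both Y and X are differentiable at t₀ ∈ (0,T), with derivatives Y'(t₀) and X'(t₀). Then for every z ∈ C satisfying ⟨ Y(t₀) − X(t₀), z − X(t₀) ⟩ = 0, one has ⟨ Y'(t₀) − X'(t₀), z − X(t₀) ⟩ ≤ 0. -/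
open Set
open scoped RealInnerProductSpace

/-- If `X(t) = P_C(Y(t))` and both `Y` and `X` are differentiable at `t₀ ∈ (0,T)`, then
for every `z ∈ C` with `⟨Y(t₀) - X(t₀), z - X(t₀)⟩ = 0` one has
`⟨Y'(t₀) - X'(t₀), z - X(t₀)⟩ ≤ 0`. -/
theorem inner_derivFree_sub_deriv_orthogonal_le
    {H : Type*} [NormedAddCommGroup H] [InnerProductSpace ℝ H] [CompleteSpace H]
    (C : Set H) (hCne : C.Nonempty) (hCcl : IsClosed C) (hCcv : Convex ℝ C)
    (P : H → H)
    (hP : ∀ x : H, P x ∈ C ∧ ∀ z ∈ C, ⟪x - P x, z - P x⟫ ≤ 0)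
    (T : ℝ) (Y : ℝ → H) (t₀ : ℝ) (ht₀ : t₀ ∈ Ioo 0 T)
    (v w : H) (hY : HasDerivAt Y v t₀) (hX : HasDerivAt (fun t => P (Y t)) w t₀) :
    ∀ z ∈ C, ⟪Y t₀ - P (Y t₀), z - P (Y t₀)⟫ = 0 →
      ⟪v - w, z - P (Y t₀)⟫ ≤ 0 := by
  intro z hz hz0
  have hf := (hY.fun_sub hX).inner ℝ (hX.const_sub z)
  have hg := (hasDerivAt_const t₀ (Y t₀ - P (Y t₀))).inner ℝ (hX.sub_const (P (Y t₀)))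
  have hf_max : IsLocalMax (fun t => ⟪Y t - P (Y t), z - P (Y t)⟫) t₀ :=
    Filter.Eventually.of_forall fun t => by
      simpa [hz0] using (hP (Y t)).2 z hz
  have hg_max : IsLocalMax (fun t => ⟪Y t₀ - P (Y t₀), P (Y t) - P (Y t₀)⟫) t₀ :=
    Filter.Eventually.of_forall fun t => by
      simpa using (hP (Y t₀)).2 _ (hP (Y t)).1
  have hf_zero := hf_max.hasDerivAt_eq_zero hf
  have hg_zero := hg_max.hasDerivAt_eq_zero hg
  simp only [inner_neg_right, inner_zero_left, add_zero] at hf_zero hg_zero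
  linarith
end

section
/- Let μ be a finite Borel measure on ℝ, let (I_j)_{j∈J} be an at most countable family of pairwise disjoint nonempty intervals of ℝ with μ(I_j) > 0 for each j, and let V ∈ L¹(ℝ, μ). Define U : ℝ → ℝ by U(y) := V(y) if y ∉ ⋃_j I_j, and U(y) := μ(I_j)⁻¹ ∫_{I_j} V dμ if y ∈ I_j. Then for every y ∈ ℝ \ ⋃_j I_j, ∫_{(−∞, y]} (U − V) dμ = 0. In particular, the function Γ(y) := ∫_{(−∞, y]} (U − V) dμ vanishes outside ⋃_j I_j. -/
open MeasureTheory Set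

/-- A function that vanishes off a countable disjoint union of measurable sets, and whose integral
over each of these sets is zero, has integral zero over any measurable set which, for each member
of the family, either contains it or is disjoint from it. No integrability is needed, since the
Bochner integral of a non-integrable function is zero. -/
theorem setIntegral_eq_zero_of_forall_subset_or_disjoint {α : Type*} [MeasurableSpace α]
    {μ : Measure α} {J : Type*} [Countable J] {s : J → Set α} {t : Set α} {f : α → ℝ}
    (hs : ∀ j, MeasurableSet (s j)) (ht : MeasurableSet t)
    (hdisj : Pairwise (Function.onFun Disjoint s))
    (hst : ∀ j, s j ⊆ t ∨ Disjoint (s j) t)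
    (hf : ∀ x ∉ ⋃ j, s j, f x = 0) (hint : ∀ j, ∫ x in s j, f x ∂μ = 0) :
    ∫ x in t, f x ∂μ = 0 := by
  by_cases hft : IntegrableOn f t μ
  · have hsub : (⋃ j, s j ∩ t) ⊆ t := iUnion_subset fun j => inter_subset_right
    rw [setIntegral_eq_of_subset_of_forall_sdiff_eq_zero ht hsub,
      integral_iUnion (fun j => (hs j).inter ht)
        (fun i j hij => (hdisj hij).mono inter_subset_left inter_subset_left)
        (hft.mono_set hsub)]
    · refine (tsum_congr fun j => ?_).trans tsum_zero
      rcases hst j with h | h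
      · rw [inter_eq_left.mpr h, hint j]
      · rw [h.inter_eq, setIntegral_empty]
    · rintro x ⟨hxt, hx⟩
      refine hf x fun hxs => hx ?_
      rw [← iUnion_inter]
      exact ⟨hxs, hxt⟩
  · exact integral_undef hft

/-- An order-connected set lies on one side of any point that it does not contain. -/
theorem Set.OrdConnected.subset_Iic_or_disjoint_Iic {α : Type*} [LinearOrder α] {s : Set α}
    (hs : s.OrdConnected) {y : α} (hy : y ∉ s) : s ⊆ Iic y ∨ Disjoint s (Iic y) := by
  by_contra! h
  obtain ⟨a, has, hay⟩ := not_subset.mp h.1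
  obtain ⟨b, hbs, hby⟩ := not_disjoint_iff.mp h.2
  exact hy (hs.out hbs has ⟨hby, (not_le.mp hay).le⟩)

/-- A function minus its average over a set of positive finite measure has integral zero there. -/
theorem setIntegral_avg_sub_eq_zero {α : Type*} [MeasurableSpace α] {μ : Measure α}
    [IsFiniteMeasure μ] {s : Set α} (hs : MeasurableSet s) (hpos : 0 < μ s) {V U : α → ℝ}
    (hV : IntegrableOn V s μ) (hU : ∀ y ∈ s, U y = (μ s).toReal⁻¹ * ∫ x in s, V x ∂μ) :
    ∫ x in s, (U x - V x) ∂μ = 0 := by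
  have hμ : (μ s).toReal ≠ 0 := (ENNReal.toReal_pos hpos.ne' (measure_ne_top μ s)).ne'
  rw [setIntegral_congr_fun (g := fun x => ((μ s).toReal⁻¹ * ∫ z in s, V z ∂μ) - V x) hs
      fun x hx => by simp only [hU x hx],
    integral_sub (integrable_const _) hV, setIntegral_const, smul_eq_mul, measureReal_def,
    mul_inv_cancel_left₀ hμ, sub_self]

/-- If `U` is obtained from `V ∈ L¹(ℝ, μ)` by replacing it, on each of the disjoint
intervals `I_j` of positive measure, by its `μ`-average over `I_j`, then
`∫_{(-∞, y]} (U - V) dμ = 0` for every `y` outside `⋃ I_j`; i.e. the adhesion potential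
`Γ(y) = ∫_{(-∞,y]} (U - V) dμ` vanishes outside `⋃ I_j`. -/
theorem integral_Iic_avg_sub_eq_zero
    (μ : Measure ℝ) [IsFiniteMeasure μ]
    {J : Type*} [Countable J] (I : J → Set ℝ)
    (hI : ∀ j, Set.OrdConnected (I j)) (hne : ∀ j, (I j).Nonempty)
    (hdisj : Pairwise (Function.onFun Disjoint I)) (hpos : ∀ j, 0 < μ (I j))
    (V : ℝ → ℝ) (hV : Integrable V μ)
    (U : ℝ → ℝ)
    (hU₁ : ∀ y, y ∉ (⋃ j, I j) → U y = V y)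
    (hU₂ : ∀ j, ∀ y ∈ I j, U y = (μ (I j)).toReal⁻¹ * ∫ x in I j, V x ∂μ) :
    ∀ y ∉ (⋃ j, I j), ∫ x in Iic y, (U x - V x) ∂μ = 0 := by
  intro y hy
  have hmeas : ∀ j, MeasurableSet (I j) := fun j => (hI j).measurableSet
  exact setIntegral_eq_zero_of_forall_subset_or_disjoint hmeas measurableSet_Iic hdisj
    (fun j => (hI j).subset_Iic_or_disjoint_Iic fun h => hy (mem_iUnion_of_mem j h))
    (fun x hx => by rw [hU₁ x hx, sub_self])
    (fun j => setIntegral_avg_sub_eq_zero (hmeas j) (hpos j) hV.integrableOn (hU₂ j))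
end
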